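/- arXiv:1912.01649 — 2 statements merged into one kernel-verified Lean document; each statement's English description precedes it below -/
import Mathlib

section
/- Let M = ⟨S, A, P, R, H, ρ₀⟩ be a finite-horizon episodic MDP with expert policy π_e, let Ŝ ⊆ S be an arbitrary subset, let M̂ be the corresponding e-stop MDP, and let π̂* be a policy maximizing J_{M̂} over all policies. Then the asymptotic sub-optimality is bounded by the total hitting probability of the removed states: J_M(π_e) − J_M(π̂*) ≤ H · Σ_{s ∈ S∖Ŝ} h(s). -/
open Finset

/-- A finite-horizon episodic MDP `⟨S, A, P, R, H, ρ₀⟩`. -/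
structure MDP (S A : Type*) [Fintype S] [Fintype A] where
  P : S → A → S → ℝ
  P_nonneg : ∀ s a s', 0 ≤ P s a s'
  P_sum : ∀ s a, ∑ s' : S, P s a s' = 1
  R : S → A → S → ℝ
  R_nonneg : ∀ s a s', 0 ≤ R s a s'
  R_le_one : ∀ s a s', R s a s' ≤ 1
  H : ℕ
  H_pos : 0 < H
  ρ0 : S → ℝ
  ρ0_nonneg : ∀ s, 0 ≤ ρ0 s
  ρ0_sum : ∑ s : S, ρ0 s = 1

/-- A (time-dependent, stochastic) policy. -/
structure Policy (S A : Type*) [Fintype A] where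
  p : ℕ → S → A → ℝ
  nonneg : ∀ t s a, 0 ≤ p t s a
  sum_one : ∀ t s, ∑ a : A, p t s a = 1

/-- The time-`t` state distribution `ρ_π^t`. -/
noncomputable def stateDist {S A : Type*} [Fintype S] [Fintype A]
    (P : S → A → S → ℝ) (pol : ℕ → S → A → ℝ) (ρ0 : S → ℝ) : ℕ → S → ℝ
  | 0 => ρ0
  | t + 1 => fun s => ∑ s' : S, ∑ a : A, stateDist P pol ρ0 t s' * pol t s' a * P s' a s

/-- Expected cumulative reward `J = ∑_{t=0}^{H-2} ∑_{s,a,s'} ρ^t(s) π(a|s,t) P(s,a,s') R(s,a,s')`. -/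
noncomputable def valueJ {S A : Type*} [Fintype S] [Fintype A]
    (P : S → A → S → ℝ) (R : S → A → S → ℝ) (H : ℕ) (ρ0 : S → ℝ)
    (pol : ℕ → S → A → ℝ) : ℝ :=
  ∑ t ∈ Finset.range (H - 1), ∑ s : S, ∑ a : A, ∑ s' : S,
    stateDist P pol ρ0 t s * pol t s a * P s a s' * R s a s'

/-- `J_M(π)`. -/
noncomputable def MDP.J {S A : Type*} [Fintype S] [Fintype A]
    (M : MDP S A) (π : Policy S A) : ℝ :=
  valueJ M.P M.R M.H M.ρ0 π.p

/-- State space `Ŝ ∪ {s_term}` of the e-stop MDP; `none` is the absorbing state `s_term`. -/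
abbrev EState (S : Type*) (Shat : Finset S) := Option {s : S // s ∈ Shat}

/-- Transition kernel of the e-stop MDP. -/
noncomputable def estopP {S A : Type*} [Fintype S] [DecidableEq S]
    (P : S → A → S → ℝ) (Shat : Finset S) :
    EState S Shat → A → EState S Shat → ℝ
  | some s, a, some s' => P s.1 a s'.1
  | some s, a, none => ∑ s' ∈ Shatᶜ, P s.1 a s'
  | none, _, some _ => 0
  | none, _, none => 1

/-- Reward of the e-stop MDP: zero on any transition into or out of `s_term`. -/
noncomputable def estopR {S A : Type*} (R : S → A → S → ℝ) (Shat : Finset S) :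
    EState S Shat → A → EState S Shat → ℝ
  | some s, a, some s' => R s.1 a s'.1
  | _, _, _ => 0

/-- Initial distribution of the e-stop MDP. -/
noncomputable def estopρ0 {S : Type*} [Fintype S] [DecidableEq S]
    (ρ0 : S → ℝ) (Shat : Finset S) : EState S Shat → ℝ
  | some s => ρ0 s.1
  | none => ∑ s ∈ Shatᶜ, ρ0 s

/-- The policy induced on the e-stop MDP by restriction (acting uniformly at `s_term`). -/
noncomputable def estopPol {S A : Type*} [Fintype A]
    (pol : ℕ → S → A → ℝ) (Shat : Finset S) :
    ℕ → EState S Shat → A → ℝ :=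
  fun t s a => match s with
    | some s => pol t s.1 a
    | none => (Fintype.card A : ℝ)⁻¹

/-- `J_{M̂}(π)`: expected cumulative reward of (the restriction of) `π` in the e-stop MDP. -/
noncomputable def estopJ {S A : Type*} [Fintype S] [DecidableEq S] [Fintype A]
    (M : MDP S A) (Shat : Finset S) (π : Policy S A) : ℝ :=
  valueJ (estopP M.P Shat) (estopR M.R Shat) M.H (estopρ0 M.ρ0 Shat) (estopPol π.p Shat)

/-- Probability of the trajectory `τ = (τ₀, …, τ_{H-1})` under policy `π` in `M`. -/
noncomputable def trajProb {S A : Type*} [Fintype S] [Fintype A]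
    (M : MDP S A) (π : Policy S A) (τ : Fin M.H → S) : ℝ :=
  M.ρ0 (τ ⟨0, M.H_pos⟩) *
    ∏ t : Fin (M.H - 1), ∑ a : A,
      π.p t.1 (τ ⟨t.1, Nat.lt_of_lt_of_le t.2 (Nat.sub_le _ _)⟩) a *
        M.P (τ ⟨t.1, Nat.lt_of_lt_of_le t.2 (Nat.sub_le _ _)⟩) a
          (τ ⟨t.1 + 1, by have := t.2; omega⟩)

/-- Hitting probability `h(s)`: the probability that `π` visits `s` during an episode. -/
noncomputable def hitProb {S A : Type*} [Fintype S] [DecidableEq S] [Fintype A]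
    (M : MDP S A) (π : Policy S A) (s : S) : ℝ :=
  ∑ τ : Fin M.H → S, trajProb M π τ * (if ∃ t, τ t = s then 1 else 0)

/-- Average state distribution `ρ_π(s) = (1/H) ∑_{t=0}^{H-1} ρ_π^t(s)`. -/
noncomputable def avgDist {S A : Type*} [Fintype S] [Fintype A]
    (M : MDP S A) (π : Policy S A) (s : S) : ℝ :=
  (M.H : ℝ)⁻¹ * ∑ t ∈ Finset.range M.H, stateDist M.P π.p M.ρ0 t s

/-- The time-`t` mass of the (possibly sub-stochastic) Markov chain with kernel `K` started from `ρ`. -/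
noncomputable def chainDist {S : Type*} [Fintype S] (K : ℕ → S → S → ℝ) (ρ : S → ℝ) :
    ℕ → S → ℝ
  | 0 => ρ
  | t + 1 => fun s => ∑ r : S, chainDist K ρ t r * K t r s

/-- The state kernel induced by a policy. -/
noncomputable def policyKernel {S A : Type*} [Fintype A]
    (P : S → A → S → ℝ) (pol : ℕ → S → A → ℝ) : ℕ → S → S → ℝ :=
  fun t s r => ∑ a : A, pol t s a * P s a r

/-- The restriction of a kernel to transitions into `Shat`. -/
noncomputable def killedKernel {S : Type*} [DecidableEq S] (K : ℕ → S → S → ℝ)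
    (Shat : Finset S) : ℕ → S → S → ℝ :=
  fun t s r => if r ∈ Shat then K t s r else 0

/-- The restriction of a mass function to `Shat`. -/
noncomputable def killedInit {S : Type*} [DecidableEq S] (ρ : S → ℝ) (Shat : Finset S) :
    S → ℝ :=
  fun s => if s ∈ Shat then ρ s else 0

theorem killed_path_weight {S : Type*} [DecidableEq S] (K : ℕ → S → S → ℝ)
    (ρ : S → ℝ) (Shat : Finset S) (n : ℕ) (τ : Fin (n + 1) → S) :
    killedInit ρ Shat (τ 0) *
        ∏ t : Fin n, killedKernel K Shat t (τ t.castSucc) (τ t.succ) =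
      if ∀ t, τ t ∈ Shat then ρ (τ 0) * ∏ t : Fin n, K t (τ t.castSucc) (τ t.succ) else 0 := by
  split_ifs with h
  · simp [killedInit, killedKernel, h]
  · push Not at h
    obtain ⟨t, ht⟩ := h
    cases t using Fin.cases with
    | zero => simp [killedInit, ht]
    | succ t =>
      exact mul_eq_zero_of_right _ (prod_eq_zero (mem_univ t) (by simp [killedKernel, ht]))

theorem sum_subtype_of_eq_zero {S : Type*} [Fintype S] {Shat : Finset S} {f : S → ℝ}
    (hf : ∀ s ∉ Shat, f s = 0) :
    ∑ s : {s : S // s ∈ Shat}, f s = ∑ s, f s := by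
  rw [sum_coe_sort Shat f]
  exact sum_subset (subset_univ _) fun s _ hs => hf s hs

section Chain

variable {S : Type*} [Fintype S]

theorem sum_chainDist_succ (K : ℕ → S → S → ℝ) (ρ : S → ℝ) (t : ℕ) :
    ∑ s, chainDist K ρ (t + 1) s = ∑ s, chainDist K ρ t s * ∑ s', K t s s' := by
  simp only [chainDist, mul_sum]
  exact sum_comm

theorem chainDist_nonneg {K : ℕ → S → S → ℝ} {ρ : S → ℝ} (hK : ∀ t s s', 0 ≤ K t s s')
    (hρ : ∀ s, 0 ≤ ρ s) (t : ℕ) (s : S) : 0 ≤ chainDist K ρ t s := by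
  induction t generalizing s with
  | zero => exact hρ s
  | succ t ih => exact sum_nonneg fun s' _ => mul_nonneg (ih s') (hK t s' s)

theorem chainDist_mono {K K' : ℕ → S → S → ℝ} {ρ ρ' : S → ℝ}
    (hK' : ∀ t s s', 0 ≤ K' t s s') (hρ' : ∀ s, 0 ≤ ρ' s)
    (hK : ∀ t s s', K' t s s' ≤ K t s s') (hρ : ∀ s, ρ' s ≤ ρ s) (t : ℕ) (s : S) :
    chainDist K' ρ' t s ≤ chainDist K ρ t s := by
  induction t generalizing s with
  | zero => exact hρ s
  | succ t ih =>
    exact sum_le_sum fun s' _ => mul_le_mul (ih s') (hK t s' s) (hK' t s' s)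
      ((chainDist_nonneg hK' hρ' t s').trans (ih s'))

theorem antitone_sum_chainDist {K : ℕ → S → S → ℝ} {ρ : S → ℝ}
    (hK : ∀ t s s', 0 ≤ K t s s') (hρ : ∀ s, 0 ≤ ρ s) (hsum : ∀ t s, ∑ s', K t s s' ≤ 1) :
    Antitone fun t => ∑ s, chainDist K ρ t s := by
  refine antitone_nat_of_succ_le fun t => ?_
  rw [sum_chainDist_succ]
  exact sum_le_sum fun s _ =>
    mul_le_of_le_one_right (chainDist_nonneg hK hρ t s) (hsum t s)

theorem sum_chainDist_eq_one {K : ℕ → S → S → ℝ} {ρ : S → ℝ} (hρ : ∑ s, ρ s = 1)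
    (hsum : ∀ t s, ∑ s', K t s s' = 1) (t : ℕ) : ∑ s, chainDist K ρ t s = 1 := by
  induction t with
  | zero => exact hρ
  | succ t ih => simp [sum_chainDist_succ, hsum, ih]

/-- Summing path weights over all paths, with a test function of the end point. -/
theorem sum_path_weight (K : ℕ → S → S → ℝ) (ρ : S → ℝ) (n : ℕ) (g : S → ℝ) :
    ∑ τ : Fin (n + 1) → S,
      ρ (τ 0) * (∏ t : Fin n, K t (τ t.castSucc) (τ t.succ)) * g (τ (Fin.last n)) =
      ∑ s, chainDist K ρ n s * g s := by
  induction n generalizing g with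
  | zero =>
    rw [← (Equiv.funUnique (Fin 1) S).symm.sum_comp]
    simp [chainDist]
  | succ n ih =>
    rw [← (Fin.snocEquiv fun _ : Fin (n + 2) => S).sum_comp, Fintype.sum_prod_type, sum_comm]
    have key : ∀ (τ : Fin (n + 1) → S) (s : S),
        ρ (Fin.snoc (α := fun _ : Fin (n + 2) => S) τ s 0) *
          (∏ t : Fin (n + 1), K t (Fin.snoc (α := fun _ : Fin (n + 2) => S) τ s t.castSucc)
            (Fin.snoc (α := fun _ : Fin (n + 2) => S) τ s t.succ)) *
          g (Fin.snoc (α := fun _ : Fin (n + 2) => S) τ s (Fin.last (n + 1))) =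
        ρ (τ 0) * (∏ t : Fin n, K t (τ t.castSucc) (τ t.succ)) *
          (K n (τ (Fin.last n)) s * g s) := by
      intro τ s
      rw [Fin.prod_univ_castSucc]
      have h0 : Fin.snoc (α := fun _ : Fin (n + 2) => S) τ s 0 = τ 0 :=
        Fin.snoc_castSucc (α := fun _ : Fin (n + 2) => S) s τ 0
      simp only [h0, Fin.snoc_castSucc, Fin.succ_castSucc, Fin.succ_last, Fin.snoc_last,
        Fin.val_castSucc, Fin.val_last]
      ring
    refine (sum_congr rfl fun τ _ => (sum_congr rfl fun s _ => key τ s).trans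
      (mul_sum _ _ _).symm).trans ?_
    rw [ih fun s' => ∑ s, K n s' s * g s]
    simp only [chainDist, mul_sum, sum_mul]
    rw [sum_comm]
    simp only [mul_assoc]

variable [DecidableEq S]

theorem chainDist_killed_eq_zero (K : ℕ → S → S → ℝ) (ρ : S → ℝ) {Shat : Finset S} (t : ℕ)
    {s : S} (hs : s ∉ Shat) :
    chainDist (killedKernel K Shat) (killedInit ρ Shat) t s = 0 := by
  cases t <;> simp [chainDist, killedKernel, killedInit, hs]

/-- Union bound: a path either stays in `Shat` or hits some state outside it. -/
theorem sum_path_weight_le_killed_add_hit {K : ℕ → S → S → ℝ} {ρ : S → ℝ}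
    (hK : ∀ t s s', 0 ≤ K t s s') (hρ : ∀ s, 0 ≤ ρ s) (Shat : Finset S) (n : ℕ) :
    ∑ s, chainDist K ρ n s ≤
      ∑ s, chainDist (killedKernel K Shat) (killedInit ρ Shat) n s +
        ∑ s ∈ Shatᶜ, ∑ τ : Fin (n + 1) → S,
          (ρ (τ 0) * ∏ t : Fin n, K t (τ t.castSucc) (τ t.succ)) *
            (if ∃ t, τ t = s then 1 else 0) := by
  have h1 := sum_path_weight K ρ n fun _ => 1
  have h2 := sum_path_weight (killedKernel K Shat) (killedInit ρ Shat) n fun _ => 1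
  simp only [mul_one] at h1 h2
  rw [← h1, ← h2, sum_comm, ← sum_add_distrib]
  refine sum_le_sum fun τ _ => ?_
  have hw : 0 ≤ ρ (τ 0) * ∏ t : Fin n, K t (τ t.castSucc) (τ t.succ) :=
    mul_nonneg (hρ _) (prod_nonneg fun t _ => hK _ _ _)
  have hnn : ∀ s ∈ Shatᶜ, 0 ≤ (ρ (τ 0) * ∏ t : Fin n, K t (τ t.castSucc) (τ t.succ)) *
      (if ∃ t, τ t = s then (1 : ℝ) else 0) :=
    fun s _ => mul_nonneg hw (by split_ifs <;> norm_num)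
  rw [killed_path_weight]
  split_ifs with h
  · exact le_add_of_nonneg_right (sum_nonneg hnn)
  · push Not at h
    obtain ⟨t, ht⟩ := h
    rw [zero_add]
    refine le_trans ?_ (single_le_sum hnn (mem_compl.2 ht))
    simp

end Chain

section Policy

variable {S A : Type*} [Fintype S] [Fintype A]

theorem policyKernel_nonneg (M : MDP S A) (π : Policy S A) (t : ℕ) (s s' : S) :
    0 ≤ policyKernel M.P π.p t s s' :=
  sum_nonneg fun a _ => mul_nonneg (π.nonneg t s a) (M.P_nonneg s a s')

theorem sum_policyKernel (M : MDP S A) (π : Policy S A) (t : ℕ) (s : S) :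
    ∑ s', policyKernel M.P π.p t s s' = 1 := by
  simp only [policyKernel]
  rw [sum_comm]
  simp [← mul_sum, M.P_sum, π.sum_one]

theorem stateDist_eq_chainDist (P : S → A → S → ℝ) (pol : ℕ → S → A → ℝ) (ρ0 : S → ℝ) (t : ℕ) :
    stateDist P pol ρ0 t = chainDist (policyKernel P pol) ρ0 t := by
  induction t with
  | zero => rfl
  | succ t ih =>
    ext s
    simp only [stateDist, chainDist, ih, policyKernel, mul_sum, mul_assoc]

theorem sum_stateDist (M : MDP S A) (π : Policy S A) (t : ℕ) :
    ∑ s, stateDist M.P π.p M.ρ0 t s = 1 := by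
  rw [stateDist_eq_chainDist]
  exact sum_chainDist_eq_one M.ρ0_sum (sum_policyKernel M π) t

theorem sum_state_transition (M : MDP S A) (π : Policy S A) (t : ℕ) :
    ∑ s, ∑ a, ∑ s', stateDist M.P π.p M.ρ0 t s * π.p t s a * M.P s a s' = 1 := by
  simp [← mul_sum, M.P_sum, π.sum_one, sum_stateDist]

variable [DecidableEq S]

/-- The state distribution of the e-stop MDP on the support states. -/
noncomputable def survivalDist (M : MDP S A) (Shat : Finset S) (π : Policy S A) : ℕ → S → ℝ :=
  chainDist (killedKernel (policyKernel M.P π.p) Shat) (killedInit M.ρ0 Shat)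

theorem killedKernel_policyKernel_nonneg (M : MDP S A) (Shat : Finset S) (π : Policy S A)
    (t : ℕ) (s s' : S) : 0 ≤ killedKernel (policyKernel M.P π.p) Shat t s s' := by
  unfold killedKernel
  split_ifs
  exacts [policyKernel_nonneg M π t s s', le_rfl]

theorem killedKernel_policyKernel_le (M : MDP S A) (Shat : Finset S) (π : Policy S A)
    (t : ℕ) (s s' : S) :
    killedKernel (policyKernel M.P π.p) Shat t s s' ≤ policyKernel M.P π.p t s s' := by
  unfold killedKernel
  split_ifs
  exacts [le_rfl, policyKernel_nonneg M π t s s']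

theorem killedInit_nonneg (M : MDP S A) (Shat : Finset S) (s : S) :
    0 ≤ killedInit M.ρ0 Shat s := by
  unfold killedInit
  split_ifs
  exacts [M.ρ0_nonneg s, le_rfl]

theorem killedInit_le (M : MDP S A) (Shat : Finset S) (s : S) :
    killedInit M.ρ0 Shat s ≤ M.ρ0 s := by
  unfold killedInit
  split_ifs
  exacts [le_rfl, M.ρ0_nonneg s]

theorem survivalDist_nonneg (M : MDP S A) (Shat : Finset S) (π : Policy S A) (t : ℕ) (s : S) :
    0 ≤ survivalDist M Shat π t s :=
  chainDist_nonneg (killedKernel_policyKernel_nonneg M Shat π) (killedInit_nonneg M Shat) t s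

theorem survivalDist_le (M : MDP S A) (Shat : Finset S) (π : Policy S A) (t : ℕ) (s : S) :
    survivalDist M Shat π t s ≤ stateDist M.P π.p M.ρ0 t s := by
  rw [stateDist_eq_chainDist]
  exact chainDist_mono (killedKernel_policyKernel_nonneg M Shat π) (killedInit_nonneg M Shat)
    (killedKernel_policyKernel_le M Shat π) (killedInit_le M Shat) t s

theorem antitone_sum_survivalDist (M : MDP S A) (Shat : Finset S) (π : Policy S A) :
    Antitone fun t => ∑ s, survivalDist M Shat π t s :=
  antitone_sum_chainDist (killedKernel_policyKernel_nonneg M Shat π) (killedInit_nonneg M Shat)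
    fun t s => (sum_le_sum fun s' _ => killedKernel_policyKernel_le M Shat π t s s').trans_eq
      (sum_policyKernel M π t s)

theorem estop_stateDist_some (M : MDP S A) (Shat : Finset S) (π : Policy S A) (t : ℕ)
    (s : {s : S // s ∈ Shat}) :
    stateDist (estopP M.P Shat) (estopPol π.p Shat) (estopρ0 M.ρ0 Shat) t (some s) =
      survivalDist M Shat π t s := by
  induction t generalizing s with
  | zero => simp [stateDist, survivalDist, chainDist, killedInit, estopρ0]
  | succ t ih =>
    have hf : ∀ s' ∉ Shat,
        ∑ a, survivalDist M Shat π t s' * π.p t s' a * M.P s' a s = 0 := fun s' hs' => by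
      simp [survivalDist, chainDist_killed_eq_zero _ _ t hs']
    simp only [stateDist, Fintype.sum_option, ih, estopP, estopPol, mul_zero, sum_const_zero,
      zero_add]
    rw [sum_subtype_of_eq_zero hf]
    simp [survivalDist, chainDist, killedKernel, policyKernel, mul_sum, mul_assoc]

theorem estopJ_eq (M : MDP S A) (Shat : Finset S) (π : Policy S A) :
    estopJ M Shat π = ∑ t ∈ range (M.H - 1), ∑ s, ∑ a, ∑ s',
      survivalDist M Shat π t s * π.p t s a * (if s' ∈ Shat then M.P s a s' else 0) *
        M.R s a s' := by
  unfold estopJ valueJ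
  refine sum_congr rfl fun t _ => ?_
  have hf : ∀ s ∉ Shat, ∑ a, ∑ s', survivalDist M Shat π t s * π.p t s a *
      (if s' ∈ Shat then M.P s a s' else 0) * M.R s a s' = 0 := fun s hs => by
    simp [survivalDist, chainDist_killed_eq_zero _ _ t hs]
  rw [← sum_subtype_of_eq_zero hf]
  simp only [Fintype.sum_option, estopR, mul_zero, sum_const_zero, zero_add,
    estop_stateDist_some, estopP, estopPol]
  refine sum_congr rfl fun s _ => sum_congr rfl fun a _ => ?_
  rw [← sum_subtype_of_eq_zero (Shat := Shat)]
  · simp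
  · intro s' hs'
    simp [hs']

theorem survival_transition_le (M : MDP S A) (Shat : Finset S) (π : Policy S A) (t : ℕ)
    (s : S) (a : A) (s' : S) :
    survivalDist M Shat π t s * π.p t s a * (if s' ∈ Shat then M.P s a s' else 0) ≤
      stateDist M.P π.p M.ρ0 t s * π.p t s a * M.P s a s' := by
  have h0 := survivalDist_nonneg M Shat π t s
  have h1 := survivalDist_le M Shat π t s
  have hp := π.nonneg t s a
  have hP := M.P_nonneg s a s'
  split_ifs
  · gcongr
  · rw [mul_zero]
    exact mul_nonneg (mul_nonneg (h0.trans h1) hp) hP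

/-- Stopping early can only lose reward. -/
theorem estopJ_le_J (M : MDP S A) (Shat : Finset S) (π : Policy S A) :
    estopJ M Shat π ≤ M.J π := by
  rw [estopJ_eq]
  exact sum_le_sum fun t _ => sum_le_sum fun s _ => sum_le_sum fun a _ => sum_le_sum fun s' _ =>
    mul_le_mul_of_nonneg_right (survival_transition_le M Shat π t s a s') (M.R_nonneg s a s')

theorem sum_survival_transition (M : MDP S A) (Shat : Finset S) (π : Policy S A) (t : ℕ) :
    ∑ s, ∑ a, ∑ s', survivalDist M Shat π t s * π.p t s a *
        (if s' ∈ Shat then M.P s a s' else 0) =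
      ∑ s, survivalDist M Shat π (t + 1) s := by
  unfold survivalDist
  rw [sum_chainDist_succ]
  refine sum_congr rfl fun s _ => ?_
  rw [sum_comm, mul_sum]
  refine sum_congr rfl fun s' _ => ?_
  by_cases h : s' ∈ Shat <;> simp [killedKernel, policyKernel, h, mul_sum, mul_assoc]

theorem J_sub_estopJ_le (M : MDP S A) (Shat : Finset S) (π : Policy S A) :
    M.J π - estopJ M Shat π ≤
      M.H * (1 - ∑ s, survivalDist M Shat π (M.H - 1) s) := by
  have hone : ∀ t, ∑ s, survivalDist M Shat π t s ≤ 1 := fun t =>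
    (sum_le_sum fun s _ => survivalDist_le M Shat π t s).trans_eq (sum_stateDist M π t)
  have hstep : ∀ t ∈ range (M.H - 1),
      (∑ s, ∑ a, ∑ s', stateDist M.P π.p M.ρ0 t s * π.p t s a * M.P s a s' * M.R s a s') -
        (∑ s, ∑ a, ∑ s', survivalDist M Shat π t s * π.p t s a *
          (if s' ∈ Shat then M.P s a s' else 0) * M.R s a s') ≤
      1 - ∑ s, survivalDist M Shat π (M.H - 1) s := by
    intro t ht
    have hanti := antitone_sum_survivalDist M Shat π
      (show t + 1 ≤ M.H - 1 from mem_range.1 ht)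
    refine le_trans ?_ (sub_le_sub_left hanti 1)
    simp only
    rw [← sum_survival_transition, ← sum_state_transition M π t]
    simp only [← sum_sub_distrib]
    refine sum_le_sum fun s _ => sum_le_sum fun a _ => sum_le_sum fun s' _ => ?_
    rw [← sub_mul]
    exact mul_le_of_le_one_right (sub_nonneg.2 (survival_transition_le M Shat π t s a s'))
      (M.R_le_one s a s')
  rw [estopJ_eq, MDP.J, valueJ, ← sum_sub_distrib]
  refine (sum_le_card_nsmul _ _ _ hstep).trans ?_
  rw [card_range, nsmul_eq_mul]
  exact mul_le_mul_of_nonneg_right (by exact_mod_cast Nat.sub_le _ _) (sub_nonneg.2 (hone _))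

theorem one_sub_survivalDist_le_sum_hitProb (M : MDP S A) (Shat : Finset S) (π : Policy S A) :
    1 - ∑ s, survivalDist M Shat π (M.H - 1) s ≤ ∑ s ∈ Shatᶜ, hitProb M π s := by
  have h := sum_path_weight_le_killed_add_hit (policyKernel_nonneg M π) M.ρ0_nonneg Shat
    (M.H - 1)
  rw [sum_chainDist_eq_one M.ρ0_sum (sum_policyKernel M π)] at h
  refine (sub_le_iff_le_add'.2 h).trans_eq ?_
  clear h
  obtain ⟨P, _, _, R, _, _, H, hH, ρ0, _, _⟩ := M
  cases H with
  | zero => exact absurd hH (lt_irrefl 0)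
  | succ n => rfl

end Policy


/-- imperfect e-stops. The asymptotic sub-optimality is bounded by `H` times
the total hitting probability of the removed states. -/
theorem imperfect_estop
    {S A : Type*} [Fintype S] [DecidableEq S] [Fintype A]
    (M : MDP S A) (πe : Policy S A) (Shat : Finset S)
    (πhatstar : Policy S A)
    (hπhatstar : ∀ π : Policy S A, estopJ M Shat π ≤ estopJ M Shat πhatstar) :
    M.J πe - M.J πhatstar ≤ (M.H : ℝ) * ∑ s ∈ Shatᶜ, hitProb M πe s := by
  have hopt := hπhatstar πe
  have hlose := estopJ_le_J M Shat πhatstar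
  have hgap := (J_sub_estopJ_le M Shat πe).trans (mul_le_mul_of_nonneg_left
    (one_sub_survivalDist_le_sum_hitProb M Shat πe) (Nat.cast_nonneg M.H))
  linarith
end

section
/- Let M = ⟨S, A, P, R, H, ρ₀⟩ be a finite-horizon episodic MDP with expert policy π_e, let Ŝ ⊆ S, and let M̂ be the corresponding e-stop MDP. If the expert never leaves Ŝ, i.e. h(s) = 0 for every s ∈ S∖Ŝ, then the expert achieves identical expected cumulative reward in both MDPs: J_{M̂}(π_e) = J_M(π_e). -/
open Finset

/-- One-step state transition probability under a policy at time `t`. -/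
noncomputable def stepProb {S A : Type*} [Fintype S] [Fintype A]
    (M : MDP S A) (π : Policy S A) (t : ℕ) (s s' : S) : ℝ :=
  ∑ a : A, π.p t s a * M.P s a s'

section Occupancy

variable {S A : Type*} [Fintype S] [Fintype A] (M : MDP S A) (π : Policy S A)

lemma stepProb_nonneg (t : ℕ) (s s' : S) : 0 ≤ stepProb M π t s s' :=
  Finset.sum_nonneg fun a _ => mul_nonneg (π.nonneg t s a) (M.P_nonneg s a s')

lemma sum_stepProb (t : ℕ) (s : S) : ∑ s' : S, stepProb M π t s s' = 1 := by
  unfold stepProb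
  rw [Finset.sum_comm]
  simp [← Finset.mul_sum, M.P_sum, π.sum_one]

lemma exists_stepProb_pos (t : ℕ) (s : S) : ∃ s', 0 < stepProb M π t s s' := by
  by_contra! h
  have := Finset.sum_nonpos fun s' (_ : s' ∈ Finset.univ) => h s'
  rw [sum_stepProb] at this
  linarith

lemma stateDist_succ_eq (t : ℕ) (s' : S) :
    stateDist M.P π.p M.ρ0 (t + 1) s' =
      ∑ s : S, stateDist M.P π.p M.ρ0 t s * stepProb M π t s s' := by
  simp only [stateDist, stepProb, Finset.mul_sum, mul_assoc]

lemma stateDist_nonneg (t : ℕ) (s : S) : 0 ≤ stateDist M.P π.p M.ρ0 t s := by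
  induction t generalizing s with
  | zero => exact M.ρ0_nonneg s
  | succ t ih =>
    rw [stateDist_succ_eq]
    exact Finset.sum_nonneg fun s' _ => mul_nonneg (ih s') (stepProb_nonneg M π t s' s)

/-- Every state starts an infinite path of positive-probability transitions. -/
lemma exists_path_from (t : ℕ) (s : S) :
    ∃ σ : ℕ → S, σ t = s ∧ ∀ i, t ≤ i → 0 < stepProb M π i (σ i) (σ (i + 1)) := by
  choose next hnext using exists_stepProb_pos M π
  refine ⟨fun i => Nat.rec s (fun k x => next (t + k) x) (i - t), by simp, fun i hi => ?_⟩
  obtain ⟨k, rfl⟩ := Nat.exists_eq_add_of_le hi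
  have h : t + k + 1 - t = k + 1 := by omega
  simp only [h, Nat.add_sub_cancel_left]
  exact hnext _ _

/-- A path leaving a reachable state extends backwards to a path from an initial state. -/
lemma exists_path_extending (t : ℕ) (σ : ℕ → S)
    (hpos : 0 < stateDist M.P π.p M.ρ0 t (σ t))
    (hσ : ∀ i, t ≤ i → 0 < stepProb M π i (σ i) (σ (i + 1))) :
    ∃ τ : ℕ → S, 0 < M.ρ0 (τ 0) ∧
      (∀ i, 0 < stepProb M π i (τ i) (τ (i + 1))) ∧ ∀ i, t ≤ i → τ i = σ i := by
  induction t generalizing σ with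
  | zero => exact ⟨σ, hpos, fun i => hσ i i.zero_le, fun _ _ => rfl⟩
  | succ t ih =>
    rw [stateDist_succ_eq] at hpos
    obtain ⟨s, -, hs⟩ := Finset.exists_lt_of_sum_lt
      (s := Finset.univ) (f := fun _ : S => (0 : ℝ)) (by simpa using hpos)
    have hs1 : 0 < stateDist M.P π.p M.ρ0 t s :=
      pos_of_mul_pos_left hs (stepProb_nonneg M π _ _ _)
    have hs2 : 0 < stepProb M π t s (σ (t + 1)) :=
      pos_of_mul_pos_right hs (stateDist_nonneg M π _ _)
    obtain ⟨τ, h0, hτ, hext⟩ := ih (fun i => if i = t then s else σ i) (by simpa using hs1) (by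
      intro i hi
      rcases hi.eq_or_lt with rfl | hlt
      · simpa using hs2
      · simpa [hlt.ne', (Nat.lt_succ_of_lt hlt).ne'] using hσ i hlt)
    refine ⟨τ, h0, hτ, fun i hi => ?_⟩
    rw [hext i (by omega), if_neg (by omega)]

lemma trajProb_nonneg (τ : Fin M.H → S) : 0 ≤ trajProb M π τ :=
  mul_nonneg (M.ρ0_nonneg _) (Finset.prod_nonneg fun _ _ => stepProb_nonneg M π _ _ _)

lemma hitProb_pos_of_stateDist_pos [DecidableEq S] {t : ℕ} (ht : t < M.H) {s : S}
    (hpos : 0 < stateDist M.P π.p M.ρ0 t s) : 0 < hitProb M π s := by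
  obtain ⟨σ, rfl, hσ⟩ := exists_path_from M π t s
  obtain ⟨τ, h0, hτ, hext⟩ := exists_path_extending M π t σ hpos hσ
  refine Finset.sum_pos' (fun τ' _ => mul_nonneg (trajProb_nonneg M π τ') (by split_ifs <;> simp))
    ⟨fun i => τ i.1, Finset.mem_univ _, ?_⟩
  rw [if_pos ⟨⟨t, ht⟩, hext t le_rfl⟩, mul_one]
  exact mul_pos h0 (Finset.prod_pos fun i _ => hτ i.1)

lemma stateDist_eq_zero_of_hitProb_eq_zero [DecidableEq S] {t : ℕ} (ht : t < M.H) {s : S}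
    (h : hitProb M π s = 0) : stateDist M.P π.p M.ρ0 t s = 0 := by
  by_contra hne
  exact (hitProb_pos_of_stateDist_pos M π ht
    ((stateDist_nonneg M π t s).lt_of_ne' hne)).ne' h

lemma stateDist_mul_eq_zero_of_succ_eq_zero {t : ℕ} {s' : S}
    (h : stateDist M.P π.p M.ρ0 (t + 1) s' = 0) (s : S) (a : A) :
    stateDist M.P π.p M.ρ0 t s * π.p t s a * M.P s a s' = 0 := by
  have hnn (s : S) (a : A) : 0 ≤ stateDist M.P π.p M.ρ0 t s * π.p t s a * M.P s a s' :=
    mul_nonneg (mul_nonneg (stateDist_nonneg M π t s) (π.nonneg t s a)) (M.P_nonneg s a s')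
  have h1 := (Finset.sum_eq_zero_iff_of_nonneg
    fun s _ => Finset.sum_nonneg fun a _ => hnn s a).1 h s (Finset.mem_univ s)
  exact (Finset.sum_eq_zero_iff_of_nonneg fun a _ => hnn s a).1 h1 a (Finset.mem_univ a)

lemma sum_subtype_eq_sum_of_eq_zero (Shat : Finset S) {f : S → ℝ}
    (hf : ∀ s, s ∉ Shat → f s = 0) : ∑ s : {s : S // s ∈ Shat}, f s = ∑ s : S, f s := by
  rw [Finset.sum_coe_sort Shat f]
  exact Finset.sum_subset (Finset.subset_univ _) fun s _ hs => hf s hs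

lemma stateDist_estop_eq [DecidableEq S] (Shat : Finset S)
    (hnever : ∀ s : S, s ∉ Shat → hitProb M π s = 0) {t : ℕ} (ht : t < M.H)
    (s : {s : S // s ∈ Shat}) :
    stateDist (estopP M.P Shat) (estopPol π.p Shat) (estopρ0 M.ρ0 Shat) t (some s) =
      stateDist M.P π.p M.ρ0 t s := by
  induction t generalizing s with
  | zero => rfl
  | succ t ih =>
    have ht' : t < M.H := by omega
    simp only [stateDist, Fintype.sum_option, estopP, estopPol, mul_zero,
      Finset.sum_const_zero, zero_add, ih ht']
    refine sum_subtype_eq_sum_of_eq_zero Shat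
      (f := fun s' => ∑ a : A, stateDist M.P π.p M.ρ0 t s' * π.p t s' a * M.P s' a s)
      fun s' hs' => ?_
    simp [stateDist_eq_zero_of_hitProb_eq_zero M π ht' (hnever s' hs')]

end Occupancy

/-- if the expert never leaves `Ŝ` (every removed state has zero hitting
probability), it collects the same expected cumulative reward in `M̂` as in `M`. -/
theorem estopJ_eq_J_of_never_leaves
    {S A : Type*} [Fintype S] [DecidableEq S] [Fintype A]
    (M : MDP S A) (πe : Policy S A) (Shat : Finset S)
    (hnever : ∀ s : S, s ∉ Shat → hitProb M πe s = 0) :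
    estopJ M Shat πe = M.J πe := by
  unfold estopJ MDP.J valueJ
  refine Finset.sum_congr rfl fun t ht => ?_
  have ht1 : t + 1 < M.H := by
    have := Finset.mem_range.1 ht
    omega
  have ht0 : t < M.H := by omega
  simp only [Fintype.sum_option, estopR, mul_zero, Finset.sum_const_zero, zero_add,
    stateDist_estop_eq M πe Shat hnever ht0, estopP, estopPol]
  rw [← sum_subtype_eq_sum_of_eq_zero Shat fun s hs => by
    simp [stateDist_eq_zero_of_hitProb_eq_zero M πe ht0 (hnever s hs)]]
  refine Finset.sum_congr rfl fun s _ => Finset.sum_congr rfl fun a _ => ?_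
  refine sum_subtype_eq_sum_of_eq_zero Shat
    (f := fun s' => stateDist M.P πe.p M.ρ0 t s * πe.p t s a * M.P s a s' * M.R s a s')
    fun s' hs' => ?_
  rw [stateDist_mul_eq_zero_of_succ_eq_zero M πe
    (stateDist_eq_zero_of_hitProb_eq_zero M πe ht1 (hnever s' hs')), zero_mul]
end
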